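/- Let (X, Σ, μ) be a complete σ-finite measure space, (Y, d) a metric space, and ℓ a von Neumann lifting of μ. Let φ : X → Y be an essentially separably valued measurable map. Then for μ-a.e. x ∈ X the following holds: for every ε > 0 there exists I ∈ 𝓘^ℓ_x such that d(φ(z), φ(x)) < ε for μ-a.e. z ∈ I. -/

import Mathlib

open MeasureTheory Set

/-- A von Neumann lifting of a measure `μ`: a Boolean homomorphism `ℓ : Σ → Σ` selecting
a.e.-representatives. -/
structure IsVNLifting {X : Type*} [MeasurableSpace X] (μ : MeasureTheory.Measure X)
    (ℓ : Set X → Set X) : Prop where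
  measurableSet : ∀ E : Set X, MeasurableSet E → MeasurableSet (ℓ E)
  map_empty : ℓ (∅ : Set X) = ∅
  map_univ : ℓ (Set.univ : Set X) = Set.univ
  map_inter : ∀ E F : Set X, MeasurableSet E → MeasurableSet F → ℓ (E ∩ F) = ℓ E ∩ ℓ F
  map_union : ∀ E F : Set X, MeasurableSet E → MeasurableSet F → ℓ (E ∪ F) = ℓ E ∪ ℓ F
  congr_ae : ∀ E F : Set X, MeasurableSet E → MeasurableSet F →
    μ (symmDiff E F) = 0 → ℓ E = ℓ F
  ae_symmDiff : ∀ E : Set X, MeasurableSet E → μ (symmDiff E (ℓ E)) = 0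
/-- The differentiation basis `𝓘^ℓ` induced by a lifting `ℓ`: all sets `ℓ E` with
`E` measurable of positive finite measure. -/
def liftBasis {X : Type*} [MeasurableSpace X] (μ : MeasureTheory.Measure X)
    (ℓ : Set X → Set X) : Set (Set X) :=
  {I | ∃ E : Set X, MeasurableSet E ∧ 0 < μ E ∧ μ E < ⊤ ∧ I = ℓ E}

/-- `HasDLim ℐ x Φ y` means `lim_{I ⇒ x} Φ(I) = y` along the differentiation basis `ℐ`:
for every neighbourhood `U` of `y` there is `I ∈ ℐ_x` with `Φ J ∈ U` for every
`J ∈ ℐ_x` with `J ⊆ I`. -/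
def HasDLim {X Y : Type*} [TopologicalSpace Y] (ℐ : Set (Set X)) (x : X)
    (Φ : Set X → Y) (y : Y) : Prop :=
  ∀ U ∈ nhds y, ∃ I ∈ ℐ, x ∈ I ∧ ∀ J ∈ ℐ, x ∈ J → J ⊆ I → Φ J ∈ U

theorem IsVNLifting.ae_eq {X : Type*} [MeasurableSpace X] {μ : Measure X} {ℓ : Set X → Set X}
    (hℓ : IsVNLifting μ ℓ) {E : Set X} (hE : MeasurableSet E) : E =ᵐ[μ] ℓ E :=
  measure_symmDiff_eq_zero_iff.1 (hℓ.ae_symmDiff E hE)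

/-- Almost every point of a set of finite measure lies in its lifting, which then belongs to the
differentiation basis. -/
theorem IsVNLifting.ae_mem_liftBasis {X : Type*} [MeasurableSpace X] {μ : Measure X}
    {ℓ : Set X → Set X} (hℓ : IsVNLifting μ ℓ) {E : Set X} (hE : MeasurableSet E)
    (hfin : μ E < ⊤) : ∀ᵐ x ∂μ, x ∈ E → ℓ E ∈ liftBasis μ ℓ ∧ x ∈ ℓ E := by
  rcases eq_or_ne (μ E) 0 with h0 | h0
  · filter_upwards [measure_eq_zero_iff_ae_notMem.1 h0] with x hx hxE
    exact absurd hxE hx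
  · filter_upwards [(hℓ.ae_eq hE).mem_iff] with x hx hxE
    exact ⟨⟨E, hE, pos_iff_ne_zero.2 h0, hfin, rfl⟩, hx.1 hxE⟩

/-- Almost every point is a point of approximate continuity, with respect to the
differentiation basis induced by a von Neumann lifting, of any essentially separably
valued measurable map into a metric space. -/
theorem ae_approx_continuity {X Y : Type*} [MeasurableSpace X]
    [MetricSpace Y] [MeasurableSpace Y] [BorelSpace Y]
    (μ : Measure X) [SigmaFinite μ] (hc : μ.IsComplete)
    (ℓ : Set X → Set X) (hℓ : IsVNLifting μ ℓ)
    (φ : X → Y) (hφ : Measurable φ)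
    (hsep : ∃ N : Set X, MeasurableSet N ∧ μ N = 0 ∧
      TopologicalSpace.IsSeparable (φ '' Nᶜ)) :
    ∀ᵐ x ∂μ, ∀ ε : ℝ, 0 < ε → ∃ I ∈ liftBasis μ ℓ, x ∈ I ∧
      ∀ᵐ z ∂(μ.restrict I), dist (φ z) (φ x) < ε := by
  obtain ⟨N, -, hN, c, hc_count, hcN⟩ := hsep
  have : Countable c := hc_count
  let E (q : c) (k m : ℕ) : Set X :=
    φ ⁻¹' Metric.ball (q : Y) (1 / ((k : ℝ) + 1)) ∩ spanningSets μ m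
  have hE q k m : MeasurableSet (E q k m) :=
    (hφ Metric.isOpen_ball.measurableSet).inter (measurableSet_spanningSets μ m)
  have hfin q k m : μ (E q k m) < ⊤ :=
    (measure_mono inter_subset_right).trans_lt (measure_spanningSets_lt_top μ m)
  have hmem : ∀ᵐ x ∂μ, ∀ q k m, x ∈ E q k m → ℓ (E q k m) ∈ liftBasis μ ℓ ∧ x ∈ ℓ (E q k m) := by
    simp only [ae_all_iff]
    exact fun q k m => hℓ.ae_mem_liftBasis (hE q k m) (hfin q k m)
  filter_upwards [hmem, measure_eq_zero_iff_ae_notMem.1 hN] with x hx hxN ε hε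
  obtain ⟨k, hk⟩ := exists_nat_one_div_lt (half_pos hε)
  obtain ⟨q, hq, hxq⟩ := Metric.mem_closure_iff.1 (hcN (mem_image_of_mem φ hxN))
    (1 / ((k : ℝ) + 1)) Nat.one_div_pos_of_nat
  obtain ⟨hI, hxI⟩ := hx ⟨q, hq⟩ k (spanningSetsIndex μ x) ⟨hxq, mem_spanningSetsIndex μ x⟩
  refine ⟨_, hI, hxI, ?_⟩
  rw [ae_restrict_iff' (hℓ.measurableSet _ (hE _ _ _))]
  filter_upwards [(hℓ.ae_eq (hE ⟨q, hq⟩ k (spanningSetsIndex μ x))).mem_iff] with z hz hzI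
  have hzq : dist (φ z) q < 1 / ((k : ℝ) + 1) := (hz.2 hzI).1
  linarith [dist_triangle_right (φ z) (φ x) q]
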